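/- arXiv:2504.15569 — 9 statements merged into one kernel-verified Lean document; each statement's English description precedes it below -/
import Mathlib

section
/- Let p be a prime and let R be a reduced, F-finite local commutative ring of characteristic p. Let f ∈ R and e ≥ 1. Then the following are equivalent: (i) there exists a p^{-e}-linear map φ: R → R (an additive map satisfying φ(r^{p^e}·x) = r·φ(x) for all r, x ∈ R) with φ(f) = 1, i.e., the R-module map R → F^e_*R sending 1 to f is split; (ii) there exists an R-linear map ψ: R_perf → R with ψ(f^{1/p^e}) = 1. -/
/-- The perfection `R_perf = PerfectClosure R p` is an `R`-algebra via the canonical map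
`R → R_perf`, hence an `R`-module. -/
noncomputable instance PerfectClosure.algebraOf (R : Type*) [CommRing R] (p : ℕ)
    [Fact p.Prime] [CharP R p] : Algebra R (PerfectClosure R p) :=
  (PerfectClosure.of R p).toAlgebra

section

variable {R : Type*} [CommRing R] {p : ℕ}

/-- Iterating a `p⁻¹`-linear map `n` times gives a `p⁻ⁿ`-linear map. -/
lemma iterate_pow_mul (σ : AddMonoid.End R) (hσ : ∀ r x : R, σ (r ^ p * x) = r * σ x)
    (n : ℕ) (r x : R) : σ^[n] (r ^ p ^ n * x) = r * σ^[n] x := by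
  induction n generalizing x with
  | zero => simp
  | succ n ih => rw [Function.iterate_succ_apply, Function.iterate_succ_apply, pow_succ, pow_mul,
      hσ, ih]

variable [Fact p.Prime] [CharP R p]

/-- The value at `x ^ (1 / p ^ n)` of the extension of a `p⁻ᵉ`-linear map `φ` to the perfection
along a Frobenius splitting `σ`. -/
def perfExtend (φ : R →+ R) (σ : AddMonoid.End R) (e n : ℕ) : R →+ R :=
  φ.comp ((σ ^ n).comp (iterateFrobenius R p e : R →+ R))

lemma perfExtend_apply (φ : R →+ R) (σ : AddMonoid.End R) (e n : ℕ) (x : R) :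
    perfExtend (p := p) φ σ e n x = φ (σ^[n] (x ^ p ^ e)) := by
  change φ ((σ ^ n) (iterateFrobenius R p e x)) = _
  rw [AddMonoid.End.coe_pow, iterateFrobenius_def]

lemma perfExtend_mul (φ : R →+ R) (σ : AddMonoid.End R) (e : ℕ) (hφ : ∀ r x : R, φ (r ^ p ^ e * x) = r * φ x)
    (hσ : ∀ r x : R, σ (r ^ p * x) = r * σ x) (n : ℕ) (r x : R) :
    perfExtend (p := p) φ σ e n (r ^ p ^ n * x) = r * perfExtend (p := p) φ σ e n x := by
  rw [perfExtend_apply, perfExtend_apply, mul_pow, pow_right_comm, iterate_pow_mul σ hσ, hφ]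

lemma perfExtend_succ (φ : R →+ R) (σ : AddMonoid.End R) (hσ : ∀ x : R, σ (x ^ p) = x) (e n : ℕ) (x : R) :
    perfExtend (p := p) φ σ e (n + 1) (x ^ p) = perfExtend (p := p) φ σ e n x := by
  rw [perfExtend_apply, perfExtend_apply, Function.iterate_succ_apply, pow_right_comm, hσ]

lemma perfExtend_add (φ : R →+ R) (σ : AddMonoid.End R) (hσ : ∀ x : R, σ (x ^ p) = x) (e n m : ℕ) (x : R) :
    perfExtend (p := p) φ σ e (n + m) ((frobenius R p)^[m] x) =
      perfExtend (p := p) φ σ e n x := by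
  induction m with
  | zero => rfl
  | succ m ih => rw [Function.iterate_succ_apply', ← add_assoc, frobenius_def,
      perfExtend_succ φ σ hσ, ih]

lemma PerfectClosure.smul_mk (r : R) (n : ℕ) (x : R) :
    r • PerfectClosure.mk R p (n, x) = PerfectClosure.mk R p (n, r ^ p ^ n * x) := by
  rw [Algebra.smul_def]
  change PerfectClosure.mk R p (0, r) * _ = _
  rw [PerfectClosure.mk_mul_mk]
  simp [← iterate_frobenius]

/-- A `p⁻ᵉ`-linear map `φ` and a Frobenius splitting `σ` extend to an `R`-linear map on the
perfection of `R`. -/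
def perfExtendLinear (φ : R →+ R) (σ : AddMonoid.End R) (e : ℕ) (hφ : ∀ r x : R, φ (r ^ p ^ e * x) = r * φ x)
    (hσ : ∀ r x : R, σ (r ^ p * x) = r * σ x) (hσ' : ∀ x : R, σ (x ^ p) = x) :
    PerfectClosure R p →ₗ[R] R where
  toFun z := z.liftOn (fun y => perfExtend (p := p) φ σ e y.1 y.2) (by
    rintro _ _ ⟨n, x⟩
    exact (perfExtend_succ φ σ hσ' e n x).symm)
  map_add' z w := by
    obtain ⟨⟨n, x⟩, rfl⟩ := PerfectClosure.mk_surjective R p z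
    obtain ⟨⟨m, y⟩, rfl⟩ := PerfectClosure.mk_surjective R p w
    rw [PerfectClosure.mk_add_mk]
    simp only [PerfectClosure.liftOn_mk, map_add]
    rw [perfExtend_add φ σ hσ', add_comm n m, perfExtend_add φ σ hσ']
  map_smul' r z := by
    obtain ⟨⟨n, x⟩, rfl⟩ := PerfectClosure.mk_surjective R p z
    rw [PerfectClosure.smul_mk]
    exact perfExtend_mul φ σ e hφ hσ n r x

end

/-- Let `p` be a prime and `R` a reduced, F-finite local commutative ring of characteristic `p`.
Let `f ∈ R` and `e ≥ 1`.  The following are equivalent: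
(i) there exists a `p^{-e}`-linear map `φ : R → R` (an additive map with
`φ (r ^ (p ^ e) * x) = r * φ x`) such that `φ f = 1`, i.e. `R → F^e_* R`, `1 ↦ f` is split;
(ii) there exists an `R`-linear map `ψ : R_perf → R` with `ψ (f ^ (1 / p ^ e)) = 1`. -/
theorem splitting_along_f_iff_splitting_from_perfection
    (p : ℕ) [Fact p.Prime] (R : Type*) [CommRing R] [CharP R p]
    [IsReduced R] [IsLocalRing R]
    [Module.Finite (RingHom.range (frobenius R p)) R]
    (f : R) (e : ℕ) (he : 1 ≤ e) :
    (∃ φ : R →+ R, (∀ r x : R, φ (r ^ p ^ e * x) = r * φ x) ∧ φ f = 1) ↔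
    (∃ ψ : PerfectClosure R p →ₗ[R] R, ψ (PerfectClosure.mk R p (e, f)) = 1) := by
  constructor
  · rintro ⟨φ, hφ, hf⟩
    let σ : AddMonoid.End R :=
      φ.comp ((AddMonoidHom.mulLeft f).comp (iterateFrobenius R p (e - 1) : R →+ R))
    have hσ_apply (x : R) : σ x = φ (f * x ^ p ^ (e - 1)) := rfl
    have hσ (r x : R) : σ (r ^ p * x) = r * σ x := by
      rw [hσ_apply, hσ_apply, mul_pow, ← pow_mul, mul_pow_sub_one (by lia), mul_left_comm, hφ]
    have hσ' (x : R) : σ (x ^ p) = x := by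
      rw [← mul_one (x ^ p), hσ, hσ_apply, one_pow, mul_one, hf, mul_one]
    refine ⟨perfExtendLinear φ σ e hφ hσ hσ', ?_⟩
    change perfExtend (p := p) φ σ e e f = 1
    rw [perfExtend_apply, ← iterate_frobenius]
    exact (congrArg φ (Function.LeftInverse.iterate (f := frobenius R p) (g := σ) hσ' e f)).trans hf
  · rintro ⟨ψ, hψ⟩
    refine ⟨AddMonoidHom.mk' (fun x => ψ (PerfectClosure.mk R p (e, x))) fun x y => ?_,
      fun r x => ?_, hψ⟩
    · rw [← map_add, PerfectClosure.mk_add_mk, ← iterate_map_add,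
        ← PerfectClosure.R.sound R p e e (x + y) _ rfl]
    · change ψ _ = r * ψ _
      rw [← PerfectClosure.smul_mk, map_smul, smul_eq_mul]
end

section
/- Let p be a prime and let R be a reduced, F-finite local commutative ring of characteristic p that is F-split, i.e., there exists a p^{-1}-linear map σ: R → R with σ(1) = 1. Then for every e ≥ 1, every p^{-e}-linear map φ: R → R extends to the perfection: there exists an R-linear map ψ: R_perf → R such that ψ(x^{1/p^e}) = φ(x) for all x ∈ R. -/
/-- The `n`-th iterate of a `p^{-1}`-linear map is `p^{-n}`-linear. -/
theorem iterate_frobenius_mul_of_frobenius_mul {R : Type*} [CommRing R] {p : ℕ} [Fact p.Prime]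
    [CharP R p] {σ : R → R} (hσ : ∀ r x : R, σ (r ^ p * x) = r * σ x) (n : ℕ) (r x : R) :
    σ^[n] ((frobenius R p)^[n] r * x) = r * σ^[n] x := by
  induction n generalizing x with
  | zero => rfl
  | succ n ih =>
    rw [Function.iterate_succ_apply, Function.iterate_succ_apply', frobenius_def, hσ, ih,
      ← Function.iterate_succ_apply]

/-- A map `σ` with `σ (r ^ p) = r` satisfies `σ^(m + n) (r ^ p ^ n) = σ^m r`. -/
theorem iterate_add_iterate_frobenius {R : Type*} [CommRing R] {p : ℕ} [Fact p.Prime]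
    [CharP R p] {σ : R → R} (hσ : Function.LeftInverse σ (frobenius R p)) (m n : ℕ) (r : R) :
    σ^[m + n] ((frobenius R p)^[n] r) = σ^[m] r := by
  rw [Function.iterate_add_apply, hσ.iterate n]

/-- An F-splitting `σ` of `R` induces additive retractions `R_perf → R^{1/p^e}`; under the
identification of `R^{1/p^e}` with `R`, it sends `x^{1/p^n}` to `σ^n (x ^ p ^ e)`. -/
def PerfectClosure.retraction {R : Type*} [CommRing R] {p : ℕ} [Fact p.Prime]
    [CharP R p] (σ : R →+ R) (hσ : Function.LeftInverse σ (frobenius R p)) (e : ℕ) :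
    PerfectClosure R p →+ R :=
  AddMonoidHom.mk'
    (fun z ↦ z.liftOn (fun x ↦ σ^[x.1] ((frobenius R p)^[e] x.2)) (by
      rintro _ _ ⟨n, x⟩
      rw [Function.iterate_succ_apply, ← Function.iterate_succ_apply (frobenius R p),
        Function.iterate_succ_apply' (frobenius R p), hσ]))
    (by
      intro a b
      induction a using PerfectClosure.induction_on with | _ x
      induction b using PerfectClosure.induction_on with | _ y
      simp only [PerfectClosure.mk_add_mk, PerfectClosure.liftOn_mk, iterate_map_add]
      rw [(Function.Commute.iterate_iterate_self _ e y.1).eq,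
        (Function.Commute.iterate_iterate_self _ e x.1).eq,
        iterate_add_iterate_frobenius hσ, add_comm x.1, iterate_add_iterate_frobenius hσ])

theorem PerfectClosure.retraction_mk {R : Type*} [CommRing R] {p : ℕ} [Fact p.Prime]
    [CharP R p] (σ : R →+ R) (hσ : Function.LeftInverse σ (frobenius R p)) (e n : ℕ) (x : R) :
    PerfectClosure.retraction σ hσ e (PerfectClosure.mk R p (n, x)) =
      σ^[n] ((frobenius R p)^[e] x) :=
  rfl

/-- Let `p` be a prime and `R` a reduced, F-finite local commutative ring of characteristic `p`
which is F-split (there is a `p^{-1}`-linear map `σ` with `σ 1 = 1`).  Then for every `e ≥ 1`,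
every `p^{-e}`-linear map `φ : R → R` extends to the perfection: there is an `R`-linear map
`ψ : R_perf → R` with `ψ (x ^ (1 / p ^ e)) = φ x` for all `x ∈ R`. -/
theorem map_extends_to_perfection_of_FSplit
    (p : ℕ) [Fact p.Prime] (R : Type*) [CommRing R] [CharP R p]
    [IsReduced R] [IsLocalRing R]
    [Module.Finite (RingHom.range (frobenius R p)) R]
    (σ : R →+ R) (hσ : ∀ r x : R, σ (r ^ p * x) = r * σ x) (hσ1 : σ 1 = 1)
    (e : ℕ) (he : 1 ≤ e)
    (φ : R →+ R) (hφ : ∀ r x : R, φ (r ^ p ^ e * x) = r * φ x) :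
    ∃ ψ : PerfectClosure R p →ₗ[R] R,
      ∀ x : R, ψ (PerfectClosure.mk R p (e, x)) = φ x := by
  have hinv : Function.LeftInverse σ (frobenius R p) := fun r ↦ by
    rw [frobenius_def, ← mul_one (r ^ p), hσ, hσ1, mul_one]
  refine ⟨{ (φ.comp (PerfectClosure.retraction σ hinv e)) with map_smul' := ?_ }, fun x ↦ ?_⟩
  · intro r z
    induction z using PerfectClosure.induction_on with | _ z
    obtain ⟨n, x⟩ := z
    have hsmul : r • PerfectClosure.mk R p (n, x) =
        PerfectClosure.mk R p (n, (frobenius R p)^[n] r * x) := by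
      rw [Algebra.smul_def]
      change PerfectClosure.mk R p (0, r) * _ = _
      simp
    rw [hsmul]
    change φ (PerfectClosure.retraction σ hinv e _) = r * φ (PerfectClosure.retraction σ hinv e _)
    rw [PerfectClosure.retraction_mk, PerfectClosure.retraction_mk, iterate_map_mul,
      ← Function.iterate_add_apply, add_comm, Function.iterate_add_apply,
      iterate_frobenius_mul_of_frobenius_mul hσ, iterate_frobenius, hφ]
  · change φ (PerfectClosure.retraction σ hinv e _) = φ x
    rw [PerfectClosure.retraction_mk, hinv.iterate e]
end

section
/- Let p be a prime, let R be a reduced, F-finite local commutative ring of characteristic p, let e ≥ 1 and f ∈ R. Let φ: R → R be a p^{-e}-linear map with φ(f) = 1, and let 𝔞 ⊆ R be an ideal such that φ(a) ∈ 𝔞 for all a ∈ 𝔞. Then there exists an R-linear map ψ: R_perf → R such that ψ(x^{1/p^e}) = φ(x) for all x ∈ R (in particular ψ(f^{1/p^e}) = 1), and such that ψ(a^{1/p^{ej}}) ∈ 𝔞 for every a ∈ 𝔞 and every j ≥ 1. -/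
namespace PerfectClosure

section Extension

variable {p : ℕ} {K : Type*} [CommRing K] {e : ℕ}

/-- The `p^{-e}`-linear map `x ↦ φ (f * x)`; it is a splitting of Frobenius if `φ f = 1`. -/
def premul (φ : K →+ K) (f : K) : K →+ K := φ.comp (AddMonoidHom.mulLeft f)

variable {φ σ : K →+ K}

theorem iterate_pow_mul (hσ : ∀ r x : K, σ (r ^ p ^ e * x) = r * σ x) (n : ℕ) (r x : K) :
    σ^[n] (r ^ p ^ (e * n) * x) = r * σ^[n] x := by
  induction n generalizing x with
  | zero => simp
  | succ n ih =>
    rw [Function.iterate_succ_apply, Function.iterate_succ_apply, mul_add_one, pow_add, pow_mul,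
      hσ, ih]

theorem iterate_pow (hσ : ∀ r x : K, σ (r ^ p ^ e * x) = r * σ x) (hσ1 : σ 1 = 1) (n : ℕ)
    (r : K) : σ^[n] (r ^ p ^ (e * n)) = r := by
  simpa [Function.iterate_fixed hσ1] using iterate_pow_mul hσ n r 1

theorem le_mul_succ (he : 1 ≤ e) (n : ℕ) : n ≤ e * (n + 1) := by nlinarith

variable [Fact p.Prime] [CharP K p]

theorem mk_add_mk_same (n : ℕ) (x y : K) :
    mk K p (n, x) + mk K p (n, y) = mk K p (n, x + y) := by
  rw [mk_add_mk, R.sound K p n n (x + y) _ rfl]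
  simp only [iterate_map_add]

theorem exists_common_denominator (u v : PerfectClosure K p) :
    ∃ (n : ℕ) (x y : K), u = mk K p (n, x) ∧ v = mk K p (n, y) := by
  obtain ⟨⟨m, x⟩, rfl⟩ := mk_surjective K p u
  obtain ⟨⟨n, y⟩, rfl⟩ := mk_surjective K p v
  exact ⟨m + n, _, _, add_comm n m ▸ R.sound K p n m x _ rfl, R.sound K p m n y _ rfl⟩

theorem algebraOf_smul_mk (r : K) (n : ℕ) (x : K) :
    r • mk K p (n, x) = mk K p (n, r ^ p ^ n * x) := by
  change mk K p (0, r) * mk K p (n, x) = _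
  simp [iterate_frobenius]

/-- The value at `x ^ (1 / p ^ n)` of the extension to the perfection of a `p^{-e}`-linear map `φ`
by means of a Frobenius splitting `σ`: regard `x ^ (1 / p ^ n)` as a `p ^ (e * (n + 1))`-th root
and apply `φ ∘ σ^[n]`. -/
def extensionAux (e : ℕ) (φ σ : K →+ K) (x : ℕ × K) : K :=
  φ (σ^[x.1] (x.2 ^ p ^ (e * (x.1 + 1) - x.1)))

theorem extensionAux_frobenius (he : 1 ≤ e) (hσ : ∀ r x : K, σ (r ^ p ^ e * x) = r * σ x)
    (hσ1 : σ 1 = 1) (n : ℕ) (x : K) :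
    extensionAux (p := p) e φ σ (n + 1, frobenius K p x) = extensionAux (p := p) e φ σ (n, x) := by
  have h : e * (n + 1 + 1) - (n + 1) + 1 = e * (n + 1) - n + e := by
    have := le_mul_succ he n
    have := le_mul_succ he (n + 1)
    rw [mul_add_one e (n + 1)] at *
    omega
  have h1 (y : K) : σ (y ^ p ^ e) = y := by simpa [hσ1] using hσ y 1
  rw [extensionAux, extensionAux, frobenius_def, ← pow_mul, ← pow_succ', h, pow_add, pow_mul,
    Function.iterate_succ_apply, h1]

/-- The extension to the perfection of a `p^{-e}`-linear map `φ` by means of a Frobenius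
splitting `σ`. -/
noncomputable def extension (he : 1 ≤ e) (hφ : ∀ r x : K, φ (r ^ p ^ e * x) = r * φ x)
    (hσ : ∀ r x : K, σ (r ^ p ^ e * x) = r * σ x) (hσ1 : σ 1 = 1) :
    PerfectClosure K p →ₗ[K] K where
  toFun u := u.liftOn (extensionAux (p := p) e φ σ) fun
    | _, _, .intro n x => (extensionAux_frobenius he hσ hσ1 n x).symm
  map_add' u v := by
    obtain ⟨n, x, y, rfl, rfl⟩ := exists_common_denominator u v
    simp only [mk_add_mk_same, liftOn_mk, extensionAux, add_pow_char_pow, iterate_map_add, map_add]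
  map_smul' r u := by
    obtain ⟨⟨n, x⟩, rfl⟩ := mk_surjective K p u
    rw [algebraOf_smul_mk]
    simp only [liftOn_mk, extensionAux, RingHom.id_apply, smul_eq_mul]
    rw [mul_pow, ← pow_mul, ← pow_add, Nat.add_sub_cancel' (le_mul_succ he n), mul_add_one,
      add_comm (e * n), pow_add, pow_mul, iterate_pow_mul hσ, hφ]

theorem extension_mk (he : 1 ≤ e) (hφ : ∀ r x : K, φ (r ^ p ^ e * x) = r * φ x)
    (hσ : ∀ r x : K, σ (r ^ p ^ e * x) = r * σ x) (hσ1 : σ 1 = 1) (k : ℕ) (x : K) :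
    extension he hφ hσ hσ1 (mk K p (e * (k + 1), x)) = φ (σ^[k] x) := by
  change φ (σ^[e * (k + 1)] (x ^ p ^ (e * (e * (k + 1) + 1) - e * (k + 1)))) = _
  obtain ⟨m, hm⟩ := Nat.exists_eq_add_of_le (le_mul_succ he k)
  rw [← Nat.mul_sub, hm, Nat.add_sub_add_right, Nat.add_sub_cancel_left,
    Function.iterate_add_apply, iterate_pow hσ hσ1]

end Extension

end PerfectClosure

/-- Let `p` be a prime, `R` a reduced, F-finite local commutative ring of characteristic `p`,
`e ≥ 1` and `f ∈ R`.  Let `φ : R → R` be a `p^{-e}`-linear map with `φ f = 1` and let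
`𝔞 ⊆ R` be an ideal with `φ a ∈ 𝔞` for all `a ∈ 𝔞`.  Then there is an `R`-linear map
`ψ : R_perf → R` with `ψ (x ^ (1 / p ^ e)) = φ x` for all `x` (in particular
`ψ (f ^ (1 / p ^ e)) = 1`), and `ψ (a ^ (1 / p ^ (e * j))) ∈ 𝔞` for all `a ∈ 𝔞`, `j ≥ 1`. -/
theorem compatible_splitting_extends_to_perfection
    (p : ℕ) [Fact p.Prime] (R : Type*) [CommRing R] [CharP R p]
    [IsReduced R] [IsLocalRing R]
    [Module.Finite (RingHom.range (frobenius R p)) R]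
    (e : ℕ) (he : 1 ≤ e) (f : R)
    (φ : R →+ R) (hφ : ∀ r x : R, φ (r ^ p ^ e * x) = r * φ x) (hφf : φ f = 1)
    (𝔞 : Ideal R) (h𝔞 : ∀ a ∈ 𝔞, φ a ∈ 𝔞) :
    ∃ ψ : PerfectClosure R p →ₗ[R] R,
      (∀ x : R, ψ (PerfectClosure.mk R p (e, x)) = φ x) ∧
      (∀ a ∈ 𝔞, ∀ j : ℕ, 1 ≤ j → ψ (PerfectClosure.mk R p (e * j, a)) ∈ 𝔞) := by
  have hσ (r x : R) : PerfectClosure.premul φ f (r ^ p ^ e * x) =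
      r * PerfectClosure.premul φ f x := by
    simp [PerfectClosure.premul, ← hφ, mul_left_comm]
  have hσ1 : PerfectClosure.premul φ f 1 = 1 := by simpa [PerfectClosure.premul] using hφf
  refine ⟨PerfectClosure.extension he hφ hσ hσ1, fun x ↦ ?_, fun a ha j hj ↦ ?_⟩
  · simpa using PerfectClosure.extension_mk he hφ hσ hσ1 0 x
  · obtain ⟨k, rfl⟩ := Nat.exists_eq_add_of_le' hj
    rw [PerfectClosure.extension_mk]
    have hmaps : Set.MapsTo (PerfectClosure.premul φ f) 𝔞 𝔞 :=
      fun x hx ↦ h𝔞 _ (𝔞.mul_mem_left f hx)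
    exact h𝔞 _ (hmaps.iterate k ha)
end

section
/- Let (R, m) be a Noetherian local ring whose residue field has characteristic p > 0, and let f: A → B be a map of R-modules such that for every n ≥ 1 the induced map A/p^nA → B/p^nB is a pure map of R-modules. Then for every R-module E in which every element is annihilated by some power of p, the induced map A ⊗_R E → B ⊗_R E is injective. -/
universe u

/-- A map of `R`-modules is pure if it stays injective after tensoring with any `R`-module. -/
def IsPureMap (R : Type u) [CommRing R] {M N : Type u} [AddCommGroup M] [Module R M]
    [AddCommGroup N] [Module R N] (f : M →ₗ[R] N) : Prop :=
  ∀ (E : Type u) [AddCommGroup E] [Module R E], Function.Injective (LinearMap.rTensor E f)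

/-- For `r : R`, the submodule `r • A` (the image of multiplication by `r`) is carried into
`r • B` by any linear map `f : A → B`; this lets us form the induced map
`A / r A → B / r B`. -/
theorem smul_range_le_comap {R A B : Type u} [CommRing R] [AddCommGroup A] [Module R A]
    [AddCommGroup B] [Module R B] (f : A →ₗ[R] B) (r : R) :
    LinearMap.range (r • (LinearMap.id : A →ₗ[R] A)) ≤
      (LinearMap.range (r • (LinearMap.id : B →ₗ[R] B))).comap f := by
  rintro x ⟨y, rfl⟩
  exact ⟨f y, by simp⟩

/-- If `r` annihilates `E`, then `E ⊗ A → E ⊗ (A / r A)` is injective. -/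
theorem lTensor_mkQ_range_smul_injective {R E A : Type*} [CommRing R] [AddCommGroup E]
    [Module R E] [AddCommGroup A] [Module R A] {r : R} (hr : ∀ x : E, r • x = 0) :
    Function.Injective
      (LinearMap.lTensor E (LinearMap.range (r • (LinearMap.id : A →ₗ[R] A))).mkQ) := by
  rw [injective_iff_map_eq_zero]
  intro t ht
  have hexact := lTensor_exact E
    (LinearMap.exact_map_mkQ_range (r • (LinearMap.id : A →ₗ[R] A))) (Submodule.mkQ_surjective _)
  obtain ⟨s, rfl⟩ := (hexact t).1 ht
  rw [LinearMap.lTensor_smul, LinearMap.lTensor_id, LinearMap.smul_apply, LinearMap.id_apply]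
  clear ht
  induction s with
  | zero => exact smul_zero _
  | tmul x a => rw [TensorProduct.smul_tmul', hr, TensorProduct.zero_tmul]
  | add s₁ s₂ h₁ h₂ => rw [smul_add, h₁, h₂, add_zero]

/-- If `r` annihilates `E` and `A / r A → B / r B` is pure, then `E ⊗ A → E ⊗ B` is injective. -/
theorem IsPureMap.lTensor_injective_of_smul_eq_zero {R E A B : Type u} [CommRing R]
    [AddCommGroup E] [Module R E] [AddCommGroup A] [Module R A] [AddCommGroup B] [Module R B]
    {f : A →ₗ[R] B} {r : R}
    (hf : IsPureMap R (Submodule.mapQ _ _ f (smul_range_le_comap f r)))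
    (hr : ∀ x : E, r • x = 0) : Function.Injective (LinearMap.lTensor E f) := by
  have hcomp := ((LinearMap.lTensor_inj_iff_rTensor_inj _ _).2 (hf E)).comp
    (lTensor_mkQ_range_smul_injective hr)
  rw [← LinearMap.coe_comp, ← LinearMap.lTensor_comp, Submodule.mapQ_mkQ,
    LinearMap.lTensor_comp, LinearMap.coe_comp] at hcomp
  exact hcomp.of_comp

/-- If `E ⊗ A → E ⊗ B` is injective after replacing `E` by any of its finitely generated
submodules, then it is injective. -/
theorem lTensor_injective_of_forall_fg {R E A B : Type*} [CommRing R]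
    [AddCommGroup E] [Module R E] [AddCommGroup A] [Module R A] [AddCommGroup B] [Module R B]
    {f : A →ₗ[R] B}
    (h : ∀ Q : Submodule R E, Q.FG → Function.Injective (LinearMap.lTensor Q f)) :
    Function.Injective (LinearMap.lTensor E f) := by
  rw [injective_iff_map_eq_zero]
  intro t ht
  obtain ⟨P, hP, t, rfl⟩ := TensorProduct.exists_of_fg t
  rw [← LinearMap.comp_apply, LinearMap.lTensor_comp_rTensor, ← LinearMap.rTensor_comp_lTensor,
    LinearMap.comp_apply] at ht
  obtain ⟨Q, hPQ, hQ, hz⟩ := TensorProduct.eq_zero_of_fg_of_subtype_eq_zero hP ht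
  rw [← LinearMap.comp_apply, LinearMap.rTensor_comp_lTensor, ← LinearMap.lTensor_comp_rTensor,
    LinearMap.comp_apply] at hz
  have ht' := (injective_iff_map_eq_zero _).1 (h Q hQ) _ hz
  rw [← Submodule.subtype_comp_inclusion P Q hPQ, LinearMap.rTensor_comp_apply, ht', map_zero]

/-- A finitely generated module whose elements are each annihilated by a power of `r` is
annihilated by a single positive power of `r`. -/
theorem Submodule.FG.exists_pow_smul_eq_zero {R E : Type*} [CommRing R] [AddCommGroup E]
    [Module R E] {Q : Submodule R E} (hQ : Q.FG) {r : R}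
    (hr : ∀ x : E, ∃ n : ℕ, r ^ n • x = 0) :
    ∃ n : ℕ, 1 ≤ n ∧ ∀ x ∈ Q, r ^ n • x = 0 := by
  obtain ⟨s, rfl⟩ := hQ
  choose k hk using hr
  refine ⟨s.sup k + 1, by omega, fun x hx => ?_⟩
  induction hx using Submodule.span_induction with
  | mem x hx =>
    obtain ⟨d, hd⟩ := Nat.exists_eq_add_of_le ((Finset.le_sup hx : k x ≤ s.sup k).trans
      (Nat.le_succ _))
    rw [← Nat.succ_eq_add_one, hd, add_comm, pow_add, mul_smul, hk, smul_zero]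
  | zero => exact smul_zero _
  | add x y _ _ hx hy => rw [smul_add, hx, hy, add_zero]
  | smul a x _ hx => rw [smul_comm, hx, smul_zero]

/-- Let `(R, 𝔪)` be a Noetherian local ring whose residue field has characteristic `p > 0`,
and let `f : A → B` be a map of `R`-modules such that for every `n ≥ 1` the induced map
`A / pⁿA → B / pⁿB` is a pure map of `R`-modules.  Then for every `R`-module `E` in which
every element is killed by a power of `p`, the map `A ⊗_R E → B ⊗_R E` is injective. -/
theorem rTensor_injective_of_p_power_torsion
    (p : ℕ) (hp : p.Prime) (R : Type u) [CommRing R] [IsNoetherianRing R] [IsLocalRing R]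
    [CharP (IsLocalRing.ResidueField R) p]
    {A B : Type u} [AddCommGroup A] [Module R A] [AddCommGroup B] [Module R B]
    (f : A →ₗ[R] B)
    (hpure : ∀ n : ℕ, 1 ≤ n →
      IsPureMap R (Submodule.mapQ _ _ f (smul_range_le_comap f ((p : R) ^ n))))
    (E : Type u) [AddCommGroup E] [Module R E]
    (hE : ∀ x : E, ∃ n : ℕ, (p : R) ^ n • x = 0) :
    Function.Injective (LinearMap.rTensor E f) := by
  rw [← LinearMap.lTensor_inj_iff_rTensor_inj]
  refine lTensor_injective_of_forall_fg fun Q hQ => ?_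
  obtain ⟨n, hn, hQn⟩ := hQ.exists_pow_smul_eq_zero hE
  exact (hpure n hn).lTensor_injective_of_smul_eq_zero fun x => Subtype.ext (hQn x x.2)
end

section
/- Let (R, m) be an m-adically complete Noetherian local ring whose residue field has characteristic p > 0, and let f: A → B be a map of R-modules such that for every n ≥ 1 the induced map A/p^nA → B/p^nB is a pure map of R-modules. Then the map Hom_R(B, R) → Hom_R(A, R) given by precomposition with f is surjective. -/
universe u

theorem isArtinianRing_quotient_maximalIdeal_pow (R : Type*) [CommRing R] [IsNoetherianRing R]
    [IsLocalRing R] (n : ℕ) : IsArtinianRing (R ⧸ IsLocalRing.maximalIdeal R ^ n) := by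
  set 𝔪 := IsLocalRing.maximalIdeal R
  by_cases hI : 𝔪 ^ n = ⊤
  · rw [hI]
    infer_instance
  have : Nontrivial (R ⧸ 𝔪 ^ n) := Ideal.Quotient.nontrivial_iff.mpr hI
  have := IsLocalRing.of_surjective' (Ideal.Quotient.mk (𝔪 ^ n)) Ideal.Quotient.mk_surjective
  have hmax : 𝔪.map (Ideal.Quotient.mk (𝔪 ^ n)) = IsLocalRing.maximalIdeal (R ⧸ 𝔪 ^ n) := by
    have := IsLocalHom.of_surjective (Ideal.Quotient.mk (𝔪 ^ n)) Ideal.Quotient.mk_surjective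
    ext x
    obtain ⟨x, rfl⟩ := Ideal.Quotient.mk_surjective x
    simp [𝔪, sup_eq_left.mpr (IsLocalRing.le_maximalIdeal hI)]
  rw [isArtinianRing_iff_isNilpotent_maximalIdeal, ← hmax]
  refine ⟨n, ?_⟩
  rw [← Ideal.map_pow, Ideal.map_quotient_self, Ideal.zero_eq_bot]

theorem Ideal.mem_of_forall_mem_sup_maximalIdeal_pow {R : Type*} [CommRing R]
    [IsNoetherianRing R] [IsLocalRing R] (I : Ideal R) {x : R}
    (hx : ∀ n : ℕ, x ∈ I ⊔ IsLocalRing.maximalIdeal R ^ n) : x ∈ I := by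
  have h := Ideal.iInf_pow_smul_eq_bot_of_isLocalRing (M := R ⧸ I) (IsLocalRing.maximalIdeal R)
    (Ideal.IsPrime.ne_top inferInstance)
  rw [← Submodule.Quotient.mk_eq_zero, ← Submodule.mem_bot R, ← h, Submodule.mem_iInf]
  intro n
  obtain ⟨a, ha, b, hb, rfl⟩ := Submodule.mem_sup.mp (hx n)
  have hab : (Submodule.Quotient.mk (a + b) : R ⧸ I) = b • Submodule.Quotient.mk 1 := by
    rw [Submodule.Quotient.mk_add, (Submodule.Quotient.mk_eq_zero I).mpr ha, zero_add,
      ← Submodule.Quotient.mk_smul, smul_eq_mul, mul_one]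
  rw [hab]
  exact Submodule.smul_mem_smul hb trivial

/-- A complete Noetherian local ring is linearly compact: a downward directed family of cosets of
ideals has a common element. -/
theorem exists_forall_sub_mem_of_antitone {R : Type*} [CommRing R] [IsNoetherianRing R]
    [IsLocalRing R] [IsAdicComplete (IsLocalRing.maximalIdeal R) R]
    {ι : Type*} [Preorder ι] [IsDirectedOrder ι] [Nonempty ι] (t : ι → R) (I : ι → Ideal R)
    (hI : Antitone I) (ht : ∀ i j, i ≤ j → t j - t i ∈ I i) :
    ∃ r : R, ∀ i, r - t i ∈ I i := by
  set 𝔪 := IsLocalRing.maximalIdeal R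
  have stable (n : ℕ) : ∃ i, ∀ j, i ≤ j → I i ≤ I j ⊔ 𝔪 ^ n := by
    have := isArtinianRing_quotient_maximalIdeal_pow R n
    obtain ⟨-, ⟨i, rfl⟩, hi⟩ := IsArtinian.set_has_minimal
      (Set.range fun i => (I i).map (Ideal.Quotient.mk (𝔪 ^ n))) (Set.range_nonempty _)
    refine ⟨i, fun j hij => ?_⟩
    have hji : (I j).map (Ideal.Quotient.mk (𝔪 ^ n)) = (I i).map (Ideal.Quotient.mk (𝔪 ^ n)) :=
      eq_of_le_of_not_lt (Ideal.map_mono (hI hij)) (hi _ ⟨j, rfl⟩)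
    have := Ideal.le_comap_map (f := Ideal.Quotient.mk (𝔪 ^ n)) (I := I i)
    rwa [← hji, Ideal.comap_map_of_surjective _ Ideal.Quotient.mk_surjective,
      ← RingHom.ker_eq_comap_bot, Ideal.mk_ker] at this
  choose i hi using stable
  let V (n : ℕ) (r : R) : Prop := ∀ j, r - t j ∈ I j ⊔ 𝔪 ^ n
  have V_of (n : ℕ) (r : R) (h : r - t (i n) ∈ I (i n) ⊔ 𝔪 ^ n) : V n r := by
    intro j
    obtain ⟨k, hik, hjk⟩ := exists_ge_ge (i n) j
    have hle : I (i n) ⊔ 𝔪 ^ n ≤ I j ⊔ 𝔪 ^ n :=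
      sup_le ((hi n k hik).trans (sup_le_sup_right (hI hjk) _)) le_sup_right
    have h₁ := hle h
    have h₂ := hle (le_sup_left (a := I (i n)) (ht _ _ hik))
    have h₃ := (le_sup_left : I j ≤ I j ⊔ 𝔪 ^ n) (ht _ _ hjk)
    convert add_mem (sub_mem h₁ h₂) h₃ using 1
    ring
  have step (n : ℕ) (r : R) (h : V n r) : ∃ r', V (n + 1) r' ∧ r' - r ∈ 𝔪 ^ n := by
    obtain ⟨a, ha, b, hb, hab⟩ := Submodule.mem_sup.mp (h (i (n + 1)))
    refine ⟨t (i (n + 1)) + a, V_of _ _ (le_sup_left (a := I _) (by simpa using ha)), ?_⟩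
    convert neg_mem hb using 1
    linear_combination hab
  have zero : V 0 0 := fun j => by simp
  choose! next hnext hsub using step
  let s : ℕ → R := fun n => Nat.rec 0 (fun n r => next n r) n
  have hs (n : ℕ) : V n (s n) := by
    induction n with
    | zero => exact zero
    | succ n ih => exact hnext n _ ih
  have hcauchy {m n : ℕ} (hmn : m ≤ n) : s m ≡ s n [SMOD (𝔪 ^ m • ⊤ : Submodule R R)] := by
    induction n, hmn using Nat.le_induction with
    | base => rfl
    | succ n hmn ih =>
      refine ih.trans (SModEq.symm ?_)
      rw [SModEq.sub_mem]
      simpa using Ideal.pow_le_pow_right hmn (hsub n _ (hs n))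
  obtain ⟨r, hr⟩ := IsPrecomplete.prec (I := 𝔪) (M := R) inferInstance hcauchy
  refine ⟨r, fun j => Ideal.mem_of_forall_mem_sup_maximalIdeal_pow _ fun n => ?_⟩
  have h₁ := (hr n).symm
  rw [SModEq.sub_mem, smul_eq_mul, Ideal.mul_top] at h₁
  convert add_mem ((le_sup_right : 𝔪 ^ n ≤ I j ⊔ 𝔪 ^ n) h₁) (hs n j) using 1
  ring

/-- A submodule `G` of `B × R`, regarded as a linear relation from `B` to `R`, extends locally if
on each finitely generated submodule of `B` it is contained in the graph of a linear form. -/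
def ExtendsLocally {R B : Type*} [CommRing R] [AddCommGroup B] [Module R B]
    (G : Submodule R (B × R)) : Prop :=
  ∀ M : Submodule R B, M.FG → ∃ Y : M →ₗ[R] R, ∀ (v : M) (r : R), ((v : B), r) ∈ G → Y v = r

theorem ExtendsLocally.sSup_of_directedOn {R B : Type*} [CommRing R] [IsNoetherianRing R] [AddCommGroup B]
    [Module R B] {c : Set (Submodule R (B × R))} (hne : c.Nonempty)
    (hdir : DirectedOn (· ≤ ·) c) (hc : ∀ G ∈ c, ExtendsLocally G) :
    ExtendsLocally (sSup c) := by
  intro M hM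
  have : Module.Finite R M := Module.Finite.iff_fg.mpr hM
  let L : M × R →ₗ[R] B × R := M.subtype.prodMap LinearMap.id
  have hfg : (((sSup c).comap L).map L).FG := (IsNoetherian.noetherian _).map L
  obtain ⟨G, hG, hle⟩ := (CompleteLattice.isCompactElement_iff_le_of_directed_sSup_le _ _).mp
    ((Submodule.fg_iff_compact _).mp hfg) c hne hdir (Submodule.map_comap_le _ _)
  obtain ⟨Y, hY⟩ := hc G hG M hM
  exact ⟨Y, fun v r h => hY v r (hle (Submodule.mem_map_of_mem (f := L) (r := (v, r)) h))⟩

theorem ExtendsLocally.exists_sup_span {R B : Type*} [CommRing R] [IsNoetherianRing R]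
    [IsLocalRing R] [IsAdicComplete (IsLocalRing.maximalIdeal R) R] [AddCommGroup B] [Module R B]
    {G : Submodule R (B × R)} (hG : ExtendsLocally G) (b : B) :
    ∃ r : R, ExtendsLocally (G ⊔ R ∙ (b, r)) := by
  let ι := {M : Submodule R B // M.FG ∧ b ∈ M}
  have : Nonempty ι := ⟨R ∙ b, Submodule.fg_span_singleton b, Submodule.mem_span_singleton_self b⟩
  have : IsDirectedOrder ι := ⟨fun M N =>
    ⟨⟨M.1 ⊔ N.1, M.2.1.sup N.2.1, (le_sup_left : M.1 ≤ M.1 ⊔ N.1) M.2.2⟩,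
      (le_sup_left : M.1 ≤ M.1 ⊔ N.1), (le_sup_right : N.1 ≤ M.1 ⊔ N.1)⟩⟩
  choose Y hY using fun M : ι => hG M.1 M.2.1
  let K (M : ι) : Submodule R (M.1 →ₗ[R] R) :=
    { carrier := {Z | ∀ (v : M.1) (r : R), ((v : B), r) ∈ G → Z v = 0}
      add_mem' := fun h₁ h₂ v r h => by simp [h₁ v r h, h₂ v r h]
      zero_mem' := fun v r h => rfl
      smul_mem' := fun a Z hZ v r h => by simp [hZ v r h] }
  let I (M : ι) : Ideal R := (K M).map (LinearMap.applyₗ (⟨b, M.2.2⟩ : M.1))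
  obtain ⟨r, hr⟩ := exists_forall_sub_mem_of_antitone (fun M : ι => Y M ⟨b, M.2.2⟩) I
    (by
      rintro M N hMN - ⟨Z, hZ, rfl⟩
      exact ⟨Z.comp (Submodule.inclusion hMN), fun v r h => hZ _ r h, rfl⟩)
    (by
      intro M N hMN
      refine ⟨(Y N).comp (Submodule.inclusion hMN) - Y M, fun v r h => ?_, rfl⟩
      rw [LinearMap.sub_apply, hY M v r h, LinearMap.comp_apply,
        hY N (Submodule.inclusion hMN v) r h, sub_self])
  refine ⟨r, fun M hM => ?_⟩
  have hle : M ≤ M ⊔ R ∙ b := le_sup_left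
  let M' : ι := ⟨M ⊔ R ∙ b, hM.sup (Submodule.fg_span_singleton b),
    (le_sup_right : R ∙ b ≤ M ⊔ R ∙ b) (Submodule.mem_span_singleton_self b)⟩
  obtain ⟨Z, hZ, hZb⟩ := hr M'
  refine ⟨(Y M' + Z).comp (Submodule.inclusion hle), fun v s hvs => ?_⟩
  obtain ⟨⟨g, s'⟩, hg, y, hy, hsum⟩ := Submodule.mem_sup.mp hvs
  obtain ⟨a, rfl⟩ := Submodule.mem_span_singleton.mp hy
  simp only [Prod.smul_mk, Prod.mk_add_mk, Prod.mk.injEq] at hsum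
  have hb : (Y M' + Z) ⟨b, M'.2.2⟩ = r := by
    change Z ⟨b, M'.2.2⟩ = _ at hZb
    rw [LinearMap.add_apply, hZb]
    ring
  let w : M'.1 := Submodule.inclusion hle v - a • ⟨b, M'.2.2⟩
  have hw : (w : B) = g := by
    change (v : B) - a • b = g
    rw [← hsum.1, add_sub_cancel_right]
  have hwG : ((w : B), s') ∈ G := hw ▸ hg
  have hwv : Submodule.inclusion hle v = w + a • ⟨b, M'.2.2⟩ := (sub_add_cancel _ _).symm
  rw [LinearMap.comp_apply, hwv, map_add, map_smul, hb, LinearMap.add_apply, hY M' w s' hwG,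
    hZ w s' hwG, add_zero, ← hsum.2]

theorem ExtendsLocally.exists_linearMap {R B : Type*} [CommRing R] [IsNoetherianRing R]
    [IsLocalRing R] [IsAdicComplete (IsLocalRing.maximalIdeal R) R] [AddCommGroup B] [Module R B]
    {G : Submodule R (B × R)} (hG : ExtendsLocally G) :
    ∃ g : B →ₗ[R] R, ∀ (b : B) (r : R), (b, r) ∈ G → g b = r := by
  obtain ⟨H, hGH, hH⟩ := zorn_le_nonempty₀ {G : Submodule R (B × R) | ExtendsLocally G}
    (fun c hc hchain y hy => ⟨sSup c, ExtendsLocally.sSup_of_directedOn ⟨y, hy⟩ hchain.directedOn hc,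
      fun _ hz => le_sSup hz⟩) G hG
  have total (b : B) : ∃ r, (b, r) ∈ H := by
    obtain ⟨r, hr⟩ := ExtendsLocally.exists_sup_span hH.prop b
    exact ⟨r, hH.le_of_ge hr le_sup_left
      ((le_sup_right : R ∙ (b, r) ≤ H ⊔ R ∙ (b, r)) (Submodule.mem_span_singleton_self _))⟩
  have unique (b : B) (r s : R) (hr : (b, r) ∈ H) (hs : (b, s) ∈ H) : r = s := by
    obtain ⟨Y, hY⟩ := hH.prop (R ∙ b) (Submodule.fg_span_singleton b)
    let v : R ∙ b := ⟨b, Submodule.mem_span_singleton_self b⟩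
    exact (hY v r hr).symm.trans (hY v s hs)
  choose g hg using total
  exact ⟨{ toFun := g
           map_add' := fun x y => unique _ _ _ (hg _) (H.add_mem (hg x) (hg y))
           map_smul' := fun a x => unique _ _ _ (hg _) (H.smul_mem a (hg x)) },
    fun b r h => unique b _ _ (hg b) (hGH h)⟩

/-- Purity of `A / s A → B / s B`, in terms of a single tensor: if `∑ f (a i) ⊗ e i` vanishes in
`B ⊗ E`, then every linear form on `A` sends `∑ a i ⊗ e i` into `s E`. -/
theorem sum_smul_mem_range_of_isPureMap {R A B E : Type u} [CommRing R] [AddCommGroup A]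
    [Module R A] [AddCommGroup B] [Module R B] [AddCommGroup E] [Module R E] (f : A →ₗ[R] B)
    (φ : A →ₗ[R] R) (s : R)
    (hpure : IsPureMap R (Submodule.mapQ _ _ f (smul_range_le_comap f s)))
    {ι : Type*} [Fintype ι] (a : ι → A) (e : ι → E) (h : ∑ i, f (a i) ⊗ₜ[R] e i = 0) :
    ∑ i, φ (a i) • e i ∈ LinearMap.range (s • (LinearMap.id : E →ₗ[R] E)) := by
  set sA := LinearMap.range (s • (LinearMap.id : A →ₗ[R] A))
  set sB := LinearMap.range (s • (LinearMap.id : B →ₗ[R] B))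
  set sE := LinearMap.range (s • (LinearMap.id : E →ₗ[R] E))
  have hzero : ∑ i, sA.mkQ (a i) ⊗ₜ[R] e i = 0 := by
    apply hpure E
    have := congrArg (LinearMap.rTensor E sB.mkQ) h
    simpa using this
  let ψ : A ⧸ sA →ₗ[R] E →ₗ[R] E ⧸ sE :=
    sA.liftQ ((LinearMap.llcomp R E E (E ⧸ sE) sE.mkQ).comp ((LinearMap.lsmul R E).comp φ)) (by
      rintro - ⟨x, rfl⟩
      ext y
      simp only [LinearMap.smul_apply, LinearMap.id_apply, map_smul, LinearMap.zero_apply]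
      rw [← map_smul]
      exact (Submodule.Quotient.mk_eq_zero sE).mpr ⟨φ x • y, smul_comm s (φ x) y⟩)
  have := congrArg (TensorProduct.lift ψ) hzero
  rw [← Submodule.Quotient.mk_eq_zero, ← Submodule.mkQ_apply]
  simpa [ψ] using this

/-- A linear system over `R` which has a solution in `B` and whose right hand side comes from `A`
has a solution in `R` after applying a linear form on `A`. -/
theorem exists_sum_mul_eq_of_isPureMap {R A B : Type u} [CommRing R] [IsNoetherianRing R]
    [IsLocalRing R] [AddCommGroup A] [Module R A] [AddCommGroup B] [Module R B] (f : A →ₗ[R] B)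
    {s : R} (hs : s ∈ IsLocalRing.maximalIdeal R)
    (hpure : ∀ n : ℕ, 1 ≤ n →
      IsPureMap R (Submodule.mapQ _ _ f (smul_range_le_comap f (s ^ n))))
    (φ : A →ₗ[R] R) {m n : ℕ} (k : Fin m → Fin n → R) (a : Fin m → A) (x : Fin n → B)
    (h : ∀ i, f (a i) = ∑ j, k i j • x j) :
    ∃ y : Fin n → R, ∀ i, φ (a i) = ∑ j, k i j * y j := by
  let W : Submodule R (Fin m → R) := LinearMap.range (Matrix.mulVecLin (Matrix.of k))
  let e (i : Fin m) : (Fin m → R) ⧸ W := W.mkQ (Pi.single i 1)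
  have he (c : Fin m → R) : ∑ i, c i • e i = W.mkQ c := by
    simp only [e, ← map_smul, ← map_sum]
    congr 1
    exact (pi_eq_sum_univ' c).symm
  have htensor : ∑ i, f (a i) ⊗ₜ[R] e i = 0 := by
    simp only [h, TensorProduct.sum_tmul, TensorProduct.smul_tmul]
    rw [Finset.sum_comm]
    refine Finset.sum_eq_zero fun j _ => ?_
    rw [← TensorProduct.tmul_sum, he fun i => k i j]
    have : W.mkQ (fun i => k i j) = 0 :=
      (Submodule.Quotient.mk_eq_zero W).mpr ⟨Pi.single j 1, by ext i; simp⟩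
    rw [this, TensorProduct.tmul_zero]
  have hmem (N : ℕ) : W.mkQ (fun i => φ (a i)) ∈
      (IsLocalRing.maximalIdeal R ^ N • ⊤ : Submodule R ((Fin m → R) ⧸ W)) := by
    rcases Nat.eq_zero_or_pos N with rfl | hN
    · simp
    obtain ⟨z, hz⟩ := sum_smul_mem_range_of_isPureMap f φ _ (hpure N hN) a e htensor
    rw [← he fun i => φ (a i), ← hz]
    exact Submodule.smul_mem_smul (Ideal.pow_mem_pow hs N) trivial
  have hzero : W.mkQ (fun i => φ (a i)) = 0 :=
    IsHausdorff.haus (I := IsLocalRing.maximalIdeal R) inferInstance _ fun N =>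
      SModEq.zero.mpr (hmem N)
  obtain ⟨y, hy⟩ := (Submodule.Quotient.mk_eq_zero W).mp hzero
  exact ⟨y, fun i => (congrFun hy i).symm⟩

theorem extendsLocally_range_prod_of_isPureMap {R A B : Type u} [CommRing R]
    [IsNoetherianRing R] [IsLocalRing R] [AddCommGroup A] [Module R A] [AddCommGroup B]
    [Module R B] (f : A →ₗ[R] B) {s : R} (hs : s ∈ IsLocalRing.maximalIdeal R)
    (hpure : ∀ n : ℕ, 1 ≤ n →
      IsPureMap R (Submodule.mapQ _ _ f (smul_range_le_comap f (s ^ n))))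
    (φ : A →ₗ[R] R) : ExtendsLocally (LinearMap.range (f.prod φ)) := by
  intro M hM
  have : Module.Finite R M := Module.Finite.iff_fg.mpr hM
  obtain ⟨n, X, hX⟩ := Module.Finite.exists_fin' R M
  let H : Submodule R ((Fin n → R) × R) := (LinearMap.range (f.prod φ)).comap
    ((M.subtype.comp X).prodMap LinearMap.id)
  obtain ⟨m, h, hH⟩ := Submodule.fg_iff_exists_fin_generating_family.mp
    (IsNoetherian.noetherian H)
  have hmem (i : Fin m) : h i ∈ H := hH ▸ Submodule.subset_span ⟨i, rfl⟩
  choose a ha using hmem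
  obtain ⟨y, hy⟩ := exists_sum_mul_eq_of_isPureMap f hs hpure φ (fun i => (h i).1) a
    (fun j => (X (Pi.single j 1) : B)) fun i => by
      have hi : f (a i) = M.subtype (X (h i).1) := congrArg Prod.fst (ha i)
      rw [hi]
      conv_lhs => rw [pi_eq_sum_univ' (h i).1]
      simp
  let Y : (Fin n → R) →ₗ[R] R := Fintype.linearCombination R y
  have hY (v : Fin n → R) (r : R) (hv : (v, r) ∈ H) : Y v = r := by
    have hle : H ≤ LinearMap.eqLocus (Y.comp (LinearMap.fst R _ R)) (LinearMap.snd R _ R) := by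
      rw [← hH, Submodule.span_le]
      rintro - ⟨i, rfl⟩
      have hi : φ (a i) = (h i).2 := congrArg Prod.snd (ha i)
      change Y (h i).1 = (h i).2
      rw [← hi, hy i]
      simp [Y, Fintype.linearCombination_apply]
    exact hle hv
  have hker : LinearMap.ker X ≤ LinearMap.ker Y := fun v hv =>
    hY v 0 ⟨0, by simp [LinearMap.mem_ker.mp hv]⟩
  refine ⟨((LinearMap.ker X).liftQ Y hker).comp
    (X.quotKerEquivOfSurjective hX).symm.toLinearMap, fun v r hv => ?_⟩
  obtain ⟨w, rfl⟩ := hX v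
  have hw : (X.quotKerEquivOfSurjective hX).symm (X w) = Submodule.Quotient.mk w := by
    rw [LinearEquiv.symm_apply_eq]
    rfl
  rw [LinearMap.comp_apply, LinearEquiv.coe_coe, hw]
  exact hY w r hv

/-- Let `(R, 𝔪)` be an `𝔪`-adically complete Noetherian local ring whose residue field has
characteristic `p > 0`, and let `f : A → B` be a map of `R`-modules such that for every
`n ≥ 1` the induced map `A / pⁿA → B / pⁿB` is a pure map of `R`-modules.  Then the map
`Hom_R(B, R) → Hom_R(A, R)`, given by precomposition with `f`, is surjective. -/
theorem hom_surjective_of_p_completely_pure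
    (p : ℕ) (hp : p.Prime) (R : Type u) [CommRing R] [IsNoetherianRing R] [IsLocalRing R]
    [CharP (IsLocalRing.ResidueField R) p]
    [IsAdicComplete (IsLocalRing.maximalIdeal R) R]
    {A B : Type u} [AddCommGroup A] [Module R A] [AddCommGroup B] [Module R B]
    (f : A →ₗ[R] B)
    (hpure : ∀ n : ℕ, 1 ≤ n →
      IsPureMap R (Submodule.mapQ _ _ f (smul_range_le_comap f ((p : R) ^ n)))) :
    Function.Surjective (fun g : B →ₗ[R] R => g.comp f) := by
  intro φ
  have hs : (p : R) ∈ IsLocalRing.maximalIdeal R := by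
    rw [← IsLocalRing.residue_eq_zero_iff, map_natCast, CharP.cast_eq_zero]
  obtain ⟨g, hg⟩ := (extendsLocally_range_prod_of_isPureMap f hs hpure φ).exists_linearMap
  exact ⟨g, LinearMap.ext fun a => hg (f a) (φ a) ⟨a, rfl⟩⟩
end

section
/- Let (R, m) be an m-adically complete Noetherian local ring whose residue field has characteristic p > 0, let B be an R-module, and let f: R → B be an R-module map such that for every n ≥ 1 the induced map R/p^nR → B/p^nB is a pure map of R-modules. Then f: R → B is pure. -/
universe u

open TensorProduct in
/-- If `b ⊗ e = 0` in `B ⊗ E`, this already holds over a finitely generated submodule of `E`. -/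
theorem exists_fg_tmul_eq_zero {R B E : Type*} [CommRing R] [AddCommGroup B] [Module R B]
    [AddCommGroup E] [Module R E] {b : B} {e : E} (h : b ⊗ₜ[R] e = 0) :
    ∃ (Q : Submodule R E) (he : e ∈ Q), Q.FG ∧ b ⊗ₜ[R] (⟨e, he⟩ : Q) = 0 := by
  have hmem : e ∈ Submodule.span R {e} := Submodule.mem_span_singleton_self e
  obtain ⟨Q, hQ, hfg, h0⟩ := TensorProduct.eq_zero_of_fg_of_subtype_eq_zero
    (Submodule.fg_span_singleton e) (t := (⟨e, hmem⟩ : Submodule.span R {e}) ⊗ₜ[R] b)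
    (by simpa using congrArg (TensorProduct.comm R B E) h)
  exact ⟨Q, hQ hmem, hfg, (congrArg (TensorProduct.comm R Q B) h0).trans (map_zero _)⟩

open TensorProduct in
/-- An element `m` of `M` with `1 ⊗ m = 0` in `(R / rR) ⊗ M` lies in `rM`. -/
theorem exists_smul_eq_of_mk_one_tmul_eq_zero {R M : Type*} [CommRing R] [AddCommGroup M]
    [Module R M] {r : R} {m : M}
    (h : (LinearMap.range (r • (LinearMap.id : R →ₗ[R] R))).mkQ 1 ⊗ₜ[R] m = 0) :
    ∃ y : M, r • y = m := by
  let N : Submodule R M := LinearMap.range (r • (LinearMap.id : M →ₗ[R] M))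
  let g : (R ⧸ LinearMap.range (r • (LinearMap.id : R →ₗ[R] R))) →ₗ[R] M →ₗ[R] M ⧸ N :=
    Submodule.liftQ _ (LinearMap.toSpanSingleton R _ N.mkQ) (by
      rintro _ ⟨x, rfl⟩
      ext z
      have : N.mkQ (r • x • z) = 0 :=
        (Submodule.Quotient.mk_eq_zero N).2 ⟨x • z, rfl⟩
      simpa [mul_smul] using this)
  have hg : g ((Submodule.mkQ _) 1) = N.mkQ := by
    rw [Submodule.mkQ_apply, Submodule.liftQ_apply, LinearMap.toSpanSingleton_apply_one]
  have h1 : N.mkQ m = 0 := by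
    rw [← hg, ← TensorProduct.lift.tmul, h, map_zero]
  exact (Submodule.Quotient.mk_eq_zero N).1 h1

/-- Let `(R, 𝔪)` be an `𝔪`-adically complete Noetherian local ring whose residue field has
characteristic `p > 0`, let `B` be an `R`-module and `f : R → B` an `R`-module map such
that for every `n ≥ 1` the induced map `R / pⁿR → B / pⁿB` is a pure map of `R`-modules.
Then `f : R → B` is pure. -/
theorem pure_of_p_completely_pure
    (p : ℕ) (hp : p.Prime) (R : Type u) [CommRing R] [IsNoetherianRing R] [IsLocalRing R]
    [CharP (IsLocalRing.ResidueField R) p]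
    [IsAdicComplete (IsLocalRing.maximalIdeal R) R]
    {B : Type u} [AddCommGroup B] [Module R B]
    (f : R →ₗ[R] B)
    (hpure : ∀ n : ℕ, 1 ≤ n →
      IsPureMap R (Submodule.mapQ _ _ f (smul_range_le_comap f ((p : R) ^ n)))) :
    IsPureMap R f := by
  intro E _ _
  rw [injective_iff_map_eq_zero]
  intro t ht
  obtain ⟨e, rfl⟩ := (TensorProduct.lid R E).symm.surjective t
  obtain ⟨Q, he, hfg, h0⟩ := exists_fg_tmul_eq_zero (b := f 1) (e := e) (by simpa using ht)
  have : Module.Finite R Q := Module.Finite.iff_fg.2 hfg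
  have hpm : Ideal.span {(p : R)} ≠ ⊤ := by
    rw [Ne, Ideal.span_singleton_eq_top]
    refine (IsLocalRing.residue_eq_zero_iff (p : R)).1 ?_
    rw [map_natCast, CharP.cast_eq_zero]
  suffices hQ : (⟨e, he⟩ : Q) ∈ (⨅ n : ℕ, Ideal.span {(p : R)} ^ n • ⊤ : Submodule R Q) by
    rw [Ideal.iInf_pow_smul_eq_bot_of_isLocalRing _ hpm, Submodule.mem_bot] at hQ
    rw [show e = 0 from congrArg Subtype.val hQ, map_zero]
  rw [Submodule.mem_iInf]
  intro n
  rcases Nat.eq_zero_or_pos n with rfl | hn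
  · simp
  · have hmk := congrArg (LinearMap.rTensor Q
      (LinearMap.range ((p : R) ^ n • (LinearMap.id : B →ₗ[R] B))).mkQ) h0
    obtain ⟨y, hy⟩ := exists_smul_eq_of_mk_one_tmul_eq_zero (r := (p : R) ^ n) (m := (⟨e, he⟩ : Q))
      (hpure n hn Q (hmk.trans ((map_zero _).trans (map_zero _).symm)))
    rw [← hy]
    exact Submodule.smul_mem_smul
      (Ideal.pow_mem_pow (Ideal.mem_span_singleton_self _) n) Submodule.mem_top
end

section
/- Let R be a reduced commutative ring, W ⊆ R its multiplicative set of nonzerodivisors, K = W^{-1}R its total ring of fractions, S the integral closure of R in K, and 𝔠 = {r ∈ R : r·s ∈ R for all s ∈ S} the conductor ideal of R. Let C be an S-algebra, let B ⊆ C be an R-subalgebra (so the image of R in C is contained in B), and let J ⊆ B be an ideal of B such that s·y ∈ J for every s ∈ S and every y ∈ J, the product being taken in C. Then for every R-linear map φ: B → R one has φ(J) ⊆ 𝔠. -/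
universe u

/-- `r : R` lies in the conductor ideal `𝔠` of `R`: for every element `s` of the integral
closure `S` of `R` in its total ring of fractions `K`, the product `r·s` lies in (the image
of) `R`. -/
def InConductor (R : Type u) [CommRing R] (r : R) : Prop :=
  ∀ s ∈ integralClosure R (FractionRing R),
    algebraMap R (FractionRing R) r * s ∈ (algebraMap R (FractionRing R)).range

/-- Let `R` be a reduced commutative ring, `K` its total ring of fractions, `S` the integral
closure of `R` in `K` and `𝔠` the conductor ideal of `R`.  Let `C` be an `S`-algebra,
`B ⊆ C` an `R`-subalgebra, and `J ⊆ B` an ideal of `B` such that `s·y ∈ J` for every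
`s ∈ S` and `y ∈ J` (the product taken in `C`).  Then for every `R`-linear map `φ : B → R`
one has `φ J ⊆ 𝔠`. -/
theorem map_S_stable_ideal_le_conductor
    (R : Type u) [CommRing R] [IsReduced R]
    (C : Type u) [CommRing C] [Algebra R C]
    [Algebra (integralClosure R (FractionRing R)) C]
    [IsScalarTower R (integralClosure R (FractionRing R)) C]
    (B : Subalgebra R C) (J : Ideal B)
    (hJ : ∀ s : integralClosure R (FractionRing R), ∀ y ∈ J,
      ∃ z ∈ J, (z : C) = algebraMap (integralClosure R (FractionRing R)) C s * (y : C))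
    (φ : B →ₗ[R] R) :
    ∀ y ∈ J, InConductor R (φ y) := by
  intro y hy s hs
  obtain ⟨z, -, hz⟩ := hJ ⟨s, hs⟩ y hy
  obtain ⟨⟨a, w⟩, haw⟩ := IsLocalization.surj (nonZeroDivisors R) s
  dsimp only at haw
  have hS : (⟨s, hs⟩ : integralClosure R (FractionRing R)) * algebraMap R _ (w : R) =
      algebraMap R _ a := Subtype.ext haw
  have hC := congrArg (algebraMap (integralClosure R (FractionRing R)) C) hS
  rw [map_mul, ← IsScalarTower.algebraMap_apply, ← IsScalarTower.algebraMap_apply] at hC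
  have hB : (w : R) • z = a • y := by
    apply Subtype.ext
    rw [Subalgebra.coe_smul, Subalgebra.coe_smul, Algebra.smul_def, Algebra.smul_def, hz, ← hC]
    ring
  have hR : (w : R) * φ z = a * φ y := by
    simpa only [map_smul, smul_eq_mul] using congrArg φ hB
  refine ⟨φ z, (IsLocalization.map_units (FractionRing R) w).mul_left_cancel ?_⟩
  rw [← map_mul, hR, map_mul, ← haw]
  ring
end

section
/- Let R be a reduced Noetherian commutative ring, K its total ring of fractions, S the integral closure of R in K, and 𝔠 = {r ∈ R : r·s ∈ R for all s ∈ S} the conductor ideal; assume that 𝔠 contains a nonzerodivisor of R. Let C be an S-algebra and let B ⊆ C be an R-subalgebra such that c·x ∈ B for every c ∈ 𝔠 and every x ∈ C. Then every R-linear map φ: B → R extends uniquely to an S-linear map ψ: C → S; that is, there is exactly one S-linear map ψ: C → S whose restriction to B equals φ composed with the inclusion R ⊆ S. Moreover, if φ(1) = 1 then ψ(1) = 1. -/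
set_option synthInstance.maxHeartbeats 400000
set_option maxHeartbeats 800000

universe u

/-- Multiplying a conductor element by an integral element yields a conductor element. -/
theorem InConductor.exists_mul_eq {R : Type u} [CommRing R] {r : R} (hr : InConductor R r)
    (s : integralClosure R (FractionRing R)) :
    ∃ t : R, InConductor R t ∧ algebraMap R (FractionRing R) r * s =
      algebraMap R (FractionRing R) t := by
  obtain ⟨t, ht⟩ := hr s s.2
  refine ⟨t, fun s' hs' => ?_, ht.symm⟩
  rw [ht, mul_assoc]
  exact hr _ (mul_mem s.2 hs')

/-- The subalgebra of the total ring of fractions of those elements that multiply the conductor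
into itself. -/
def conductorMultiplier (R : Type u) [CommRing R] : Subalgebra R (FractionRing R) where
  carrier := {z | ∀ d : R, InConductor R d → ∃ e : R, InConductor R e ∧
    algebraMap R (FractionRing R) d * z = algebraMap R (FractionRing R) e}
  mul_mem' := by
    intro a b ha hb d hd
    obtain ⟨e, he, h⟩ := ha d hd
    obtain ⟨f, hf, h'⟩ := hb e he
    exact ⟨f, hf, by rw [← mul_assoc, h, h']⟩
  add_mem' := by
    intro a b ha hb d hd
    obtain ⟨e, he, h⟩ := ha d hd
    obtain ⟨f, hf, h'⟩ := hb d hd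
    refine ⟨e + f, fun s hs => ?_, by rw [mul_add, h, h', map_add]⟩
    rw [map_add, add_mul]
    exact add_mem (he s hs) (hf s hs)
  algebraMap_mem' := by
    intro r d hd
    refine ⟨d * r, fun s hs => ?_, by rw [map_mul]⟩
    rw [map_mul, mul_assoc]
    exact hd _ (mul_mem (algebraMap_mem _ r) hs)

/-- Over a Noetherian ring whose conductor contains a nonzerodivisor, multipliers of the
conductor are integral. -/
theorem conductorMultiplier_le_integralClosure {R : Type u} [CommRing R] [IsNoetherianRing R]
    {c : R} (hc : c ∈ nonZeroDivisors R) (hcc : InConductor R c) :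
    conductorMultiplier R ≤ integralClosure R (FractionRing R) := by
  intro y hy
  let N : Submodule R (FractionRing R) := R ∙ (IsLocalization.mk' (FractionRing R) 1 ⟨c, hc⟩)
  have hle : Subalgebra.toSubmodule (conductorMultiplier R) ≤ N := by
    intro z hz
    obtain ⟨e, -, h⟩ := hz c hcc
    refine Submodule.mem_span_singleton.2 ⟨e, ?_⟩
    rw [Algebra.smul_def, ← h, mul_right_comm, IsLocalization.mk'_spec'_mk, map_one, one_mul]
  have : IsNoetherian R N := isNoetherian_span_of_finite R (Set.finite_singleton _)
  exact IsIntegral.of_mem_of_fg _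
    (isNoetherian_submodule.1 this _ hle) y hy

/-- Let `R` be a reduced Noetherian ring, `K` its total ring of fractions, `S` the integral
closure of `R` in `K` and `𝔠` the conductor ideal; assume `𝔠` contains a nonzerodivisor.
Let `C` be an `S`-algebra and `B ⊆ C` an `R`-subalgebra with `c·x ∈ B` for all `c ∈ 𝔠`,
`x ∈ C`.  Then every `R`-linear map `φ : B → R` extends uniquely to an `S`-linear map
`ψ : C → S` (i.e. `ψ` restricted to `B` is `φ` followed by the inclusion `R ⊆ S`); moreover
if `φ 1 = 1` then `ψ 1 = 1`. -/
theorem extend_to_normalization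
    (R : Type u) [CommRing R] [IsReduced R] [IsNoetherianRing R]
    (C : Type u) [CommRing C] [Algebra R C]
    [Algebra (integralClosure R (FractionRing R)) C]
    [IsScalarTower R (integralClosure R (FractionRing R)) C]
    (hc : ∃ c ∈ nonZeroDivisors R, InConductor R c)
    (B : Subalgebra R C)
    (hB : ∀ c : R, InConductor R c → ∀ x : C, algebraMap R C c * x ∈ B)
    (φ : B →ₗ[R] R) :
    (∃! ψ : C →ₗ[integralClosure R (FractionRing R)] integralClosure R (FractionRing R),
      ∀ b : B, ψ (b : C) = algebraMap R (integralClosure R (FractionRing R)) (φ b)) ∧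
    (φ 1 = 1 →
      ∀ ψ : C →ₗ[integralClosure R (FractionRing R)] integralClosure R (FractionRing R),
        (∀ b : B, ψ (b : C) = algebraMap R (integralClosure R (FractionRing R)) (φ b)) →
        ψ 1 = 1) := by
  obtain ⟨c, hc, hcc⟩ := hc
  have hcu : IsUnit (algebraMap R (FractionRing R) c) :=
    IsLocalization.map_units (FractionRing R) ⟨c, hc⟩
  have hswap (d e : R) (hd : InConductor R d) (he : InConductor R e) (x : C) :
      d * φ ⟨_, hB e he x⟩ = e * φ ⟨_, hB d hd x⟩ := by
    rw [← smul_eq_mul, ← smul_eq_mul (a := e), ← map_smul, ← map_smul]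
    congr 1
    ext
    change d • (algebraMap R C e * x) = e • (algebraMap R C d * x)
    simp only [Algebra.smul_def]
    ring
  have hmul (d e : R) (s : integralClosure R (FractionRing R))
      (h : algebraMap R (FractionRing R) d * s = algebraMap R (FractionRing R) e) (x : C) :
      algebraMap R C d * (s • x) = algebraMap R C e * x := by
    have h' : d • s = algebraMap R (integralClosure R (FractionRing R)) e := Subtype.ext (by
      rw [SetLike.val_smul, Algebra.smul_def, h]; rfl)
    rw [← Algebra.smul_def, ← Algebra.smul_def, ← smul_assoc, h', algebraMap_smul]
  have hex (x : C) : ∃ y : integralClosure R (FractionRing R),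
      algebraMap R (FractionRing R) c * y = algebraMap R (FractionRing R) (φ ⟨_, hB c hcc x⟩) := by
    obtain ⟨y, hy⟩ := hcu.dvd (a := algebraMap R (FractionRing R) (φ ⟨_, hB c hcc x⟩))
    have hdy (d : R) (hd : InConductor R d) : algebraMap R (FractionRing R) d * y =
        algebraMap R (FractionRing R) (φ ⟨_, hB d hd x⟩) := by
      apply hcu.mul_left_cancel
      rw [mul_left_comm, ← hy, ← map_mul, ← map_mul, hswap d c hd hcc]
    refine ⟨⟨y, conductorMultiplier_le_integralClosure hc hcc fun d hd =>
      ⟨_, fun s hs => ?_, hdy d hd⟩⟩, hy.symm⟩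
    obtain ⟨e, he, h⟩ := hd.exists_mul_eq ⟨s, hs⟩
    rw [← hdy d hd, mul_right_comm, h, hdy e he]
    exact ⟨_, rfl⟩
  choose f hf using hex
  have hcancel {y z : integralClosure R (FractionRing R)}
      (h : algebraMap R (FractionRing R) c * y = algebraMap R (FractionRing R) c * z) : y = z :=
    Subtype.ext (hcu.mul_left_cancel h)
  refine ⟨⟨{ toFun := f
             map_add' := fun x y => hcancel ?_
             map_smul' := fun s x => hcancel ?_ }, fun b => hcancel ?_,
    fun ψ hψ => LinearMap.ext fun x => hcancel ?_⟩, fun h ψ hψ => ?_⟩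
  · rw [Subalgebra.coe_add, mul_add, hf, hf, hf, ← map_add, ← map_add]
    congr 2
    ext
    exact mul_add _ _ _
  · obtain ⟨e, he, h⟩ := hcc.exists_mul_eq s
    rw [RingHom.id_apply, smul_eq_mul, Subalgebra.coe_mul, ← mul_assoc, h, hf]
    apply hcu.mul_left_cancel
    rw [mul_left_comm, hf, ← map_mul, ← map_mul, hswap e c he hcc]
    congr 4
    exact hmul c e s h x
  · change _ * (f b).1 = _ * algebraMap R (FractionRing R) (φ b)
    rw [hf, ← map_mul, ← smul_eq_mul (a := c) (b := φ b), ← map_smul]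
    congr 2
    ext
    exact (Algebra.smul_def _ _).symm
  · change _ = _ * (f x).1
    have h := hψ ⟨_, hB c hcc x⟩
    have h' : ψ (algebraMap R C c * x) =
        algebraMap R (integralClosure R (FractionRing R)) c * ψ x := by
      rw [← Algebra.smul_def, ← algebraMap_smul (integralClosure R (FractionRing R)) c x, map_smul,
        smul_eq_mul]
    rw [hf]
    exact congrArg Subtype.val (h'.symm.trans h)
  · have h1 := hψ 1
    rwa [h, map_one, Subalgebra.coe_one] at h1
end

section
/- Let R be a commutative ring, let 𝒞 be a family of ideals of R closed under intersections of arbitrary nonempty subfamilies, and let U ⊆ Spec R be a subset such that for every 𝔭 ∈ U the family {I ∈ 𝒞 : I ⊆ 𝔭} is nonempty and has a greatest element β(𝔭), and such that β(𝔭) is a prime ideal lying in U. Then the map β: U → U, 𝔭 ↦ β(𝔭), is continuous for the Zariski topology. -/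
universe u

/-- Let `R` be a commutative ring, `𝒞` a family of ideals of `R` closed under intersections
of arbitrary nonempty subfamilies, and `U ⊆ Spec R` a subset such that for every `𝔭 ∈ U`
the family `{I ∈ 𝒞 : I ⊆ 𝔭}` is nonempty and has a greatest element `β 𝔭`, which is a prime
ideal lying in `U`.  Then `β : U → U` is continuous for the Zariski topology. -/
theorem compatible_core_map_continuous
    (R : Type u) [CommRing R] (𝒞 : Set (Ideal R))
    (hinter : ∀ T : Set (Ideal R), T ⊆ 𝒞 → T.Nonempty → sInf T ∈ 𝒞)
    (U : Set (PrimeSpectrum R)) (β : U → U)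
    (hβ : ∀ 𝔭 : U, IsGreatest {I | I ∈ 𝒞 ∧ I ≤ (𝔭 : PrimeSpectrum R).asIdeal}
      ((β 𝔭 : PrimeSpectrum R).asIdeal)) :
    Continuous β := by
  refine continuous_iff_isClosed.mpr fun Z hZ => ?_
  obtain ⟨Z', hZ', rfl⟩ := isClosed_induced_iff.mp hZ
  obtain ⟨I, rfl⟩ := (PrimeSpectrum.isClosed_iff_zeroLocus_ideal Z').mp hZ'
  rcases Set.eq_empty_or_nonempty {J | J ∈ 𝒞 ∧ I ≤ J} with hT | hT
  · convert isClosed_empty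
    refine Set.eq_empty_of_forall_notMem fun 𝔭 h𝔭 => ?_
    exact hT.subset (show _ ∈ {J | J ∈ 𝒞 ∧ I ≤ J} from ⟨(hβ 𝔭).1.1, h𝔭⟩)
  · have hmem := hinter _ (fun J hJ => hJ.1) hT
    have hle : I ≤ sInf {J | J ∈ 𝒞 ∧ I ≤ J} := le_sInf fun J hJ => hJ.2
    refine isClosed_induced_iff.mpr ⟨PrimeSpectrum.zeroLocus (sInf {J | J ∈ 𝒞 ∧ I ≤ J} : Ideal R),
      PrimeSpectrum.isClosed_zeroLocus _, Set.ext fun 𝔭 => ⟨fun h => ?_, fun h => ?_⟩⟩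
    · exact hle.trans ((hβ 𝔭).2 ⟨hmem, h⟩)
    · exact (sInf_le (show _ ∈ {J | J ∈ 𝒞 ∧ I ≤ J} from ⟨(hβ 𝔭).1.1, h⟩)).trans (hβ 𝔭).1.2
end
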